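/- Let K be a number field, let R ⊂ K be a Dedekind domain with O_K ⊆ R, let H be a finite-dimensional Hopf algebra over K, and let X be a Hopf order of H over R. Then every character of H (i.e. the character of any finite-dimensional representation of H) belongs to the dual order X⋆ := {φ ∈ H* : φ(X) ⊆ R}, and every character of H* (cocharacter of H) belongs to X. In particular, every group-like element of H belongs to X. -/

import Mathlib

open TensorProduct

noncomputable section


/-- The natural map `X ⊗[R] K → H` sending `x ⊗ c` to `c • x`. -/
noncomputable def ordNatMap (R K H : Type*) [CommRing R] [Field K]
    [Algebra R K] [AddCommGroup H] [Module K H] [Module R H] [IsScalarTower R K H]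
    (X : Submodule R H) : X ⊗[R] K →ₗ[R] H :=
  TensorProduct.lift
    { toFun := fun x => ((LinearMap.toSpanSingleton K H (x : H)).restrictScalars R)
      map_add' := by intro x y; ext c; simp [smul_add]
      map_smul' := by
        intro r x
        ext c
        simp only [LinearMap.coe_restrictScalars, LinearMap.toSpanSingleton_apply,
          LinearMap.smul_apply, SetLike.val_smul]
        rw [smul_comm]; rfl }

/-- The `R`-submodule of `H ⊗[K] H` spanned by elementary tensors `a ⊗ b` with
`a ∈ X`, `b ∈ Y`; this is the image of `X ⊗[R] Y` in `H ⊗[K] H`. -/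
def spanPairs (R K H : Type*) [CommRing R] [Field K]
    [Algebra R K] [AddCommGroup H] [Module K H] [Module R H] [IsScalarTower R K H]
    (X Y : Submodule R H) : Submodule R (H ⊗[K] H) :=
  Submodule.span R {z : H ⊗[K] H | ∃ a ∈ X, ∃ b ∈ Y, z = a ⊗ₜ[K] b}

/-- `X` is a Hopf order, over the subring `R` of `K`, of the subspace `W` of `V`, where
`V` carries (possibly twisted) Hopf-algebra structure maps `one`, `mul`, `Δ`, `ε`, `S`:
`X` is a finitely generated projective `R`-submodule with `X ⊗_R K ≅ W` naturally
(injectivity of the natural map plus `span_K X = W`), containing `one`, closed under `mul`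
and the antipode `S`, with `Δ(X) ⊆ X ⊗_R X` and `ε(X) ⊆ R`. -/
structure IsHopfOrderWith (R K V : Type*) [CommRing R] [Field K]
    [Algebra R K] [AddCommGroup V] [Module K V] [Module R V] [IsScalarTower R K V]
    (one : V) (mul : V → V → V) (W : Submodule K V)
    (Δ : V → V ⊗[K] V) (ε : V → K) (S : V → V) (X : Submodule R V) : Prop where
  fg : X.FG
  projective : Module.Projective R X
  inj : Function.Injective (ordNatMap R K V X)
  span_eq : Submodule.span K (X : Set V) = W
  one_mem : one ∈ X
  mul_mem : ∀ x ∈ X, ∀ y ∈ X, mul x y ∈ X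
  comul_mem : ∀ x ∈ X, Δ x ∈ spanPairs R K V X X
  counit_mem : ∀ x ∈ X, ε x ∈ Set.range (algebraMap R K)
  antipode_mem : ∀ x ∈ X, S x ∈ X


/-- The convolution product on the dual `H* = Hom_K(H, K)` of a coalgebra `H`:
`(φ * ψ)(h) = Σ φ(h₍₁₎) ψ(h₍₂₎)`.  This is the multiplication of the dual algebra. -/
def dualConv (K H : Type*) [Field K] [AddCommGroup H] [Module K H] [Coalgebra K H]
    (φ ψ : Module.Dual K H) : Module.Dual K H :=
  (TensorProduct.lid K K).toLinearMap ∘ₗ TensorProduct.map φ ψ ∘ₗ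
    Coalgebra.comul (R := K) (A := H)

open Polynomial in
theorem aux_matrix_trace {R K n : Type*} [CommRing R] [Field K] [Algebra R K]
    [Fintype n] [DecidableEq n] (A : Matrix n n K) (p : R[X]) (hp : p.Monic)
    (h : aeval A (p.map (algebraMap R K)) = 0) : IsIntegral R A.trace := by
  let L := AlgebraicClosure K
  have hinj : Function.Injective (algebraMap K L) := (algebraMap K L).injective
  rw [← isIntegral_algHom_iff (IsScalarTower.toAlgHom R K L) hinj]
  rw [IsScalarTower.coe_toAlgHom']
  set B : Matrix n n L := A.map (algebraMap K L) with hB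
  have htr : algebraMap K L A.trace = B.trace := by
    simp [hB, Matrix.trace, map_sum]
  have hq : aeval B ((p.map (algebraMap R K)).map (algebraMap K L)) = 0 := by
    have h2 : B = (Algebra.ofId K L).mapMatrix A := rfl
    rw [aeval_map_algebraMap, h2, aeval_algHom_apply, h, map_zero]
  rw [htr, Matrix.trace_eq_sum_roots_charpoly]
  apply IsIntegral.multiset_sum
  intro μ hμ
  have hμ' : μ ∈ spectrum L B :=
    Matrix.mem_spectrum_of_isRoot_charpoly (isRoot_of_mem_roots hμ)
  have := spectrum.subset_polynomial_aeval B
    ((p.map (algebraMap R K)).map (algebraMap K L)) ⟨μ, hμ', rfl⟩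
  rw [hq] at this
  have hne : Nontrivial (Matrix n n L) := by
    by_contra hc
    rw [not_nontrivial_iff_subsingleton] at hc
    exact (spectrum.mem_iff.1 hμ') (isUnit_of_subsingleton _)
  rw [spectrum.zero_eq, Set.mem_singleton_iff] at this
  refine ⟨p, hp, ?_⟩
  rw [IsScalarTower.algebraMap_eq R K L, ← eval_map, ← Polynomial.map_map]
  exact this

theorem aux_trace_mem {R K V : Type*} [CommRing R] [IsDomain R] [IsIntegrallyClosed R] [Field K]
    [Algebra R K] [IsFractionRing R K] [AddCommGroup V] [Module K V] [FiniteDimensional K V]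
    [Module R V] [IsScalarTower R K V]
    (M : Submodule R (Module.End K V)) (hfg : M.FG) (h1 : 1 ∈ M)
    (hmul : ∀ x ∈ M, ∀ y ∈ M, x * y ∈ M) (x : Module.End K V) (hx : x ∈ M) :
    LinearMap.trace K V x ∈ Set.range (algebraMap R K) := by
  let S : Subalgebra R (Module.End K V) := M.toSubalgebra h1 (fun x y hx hy => hmul x hx y hy)
  have hS : S.toSubmodule.FG := by
    have : S.toSubmodule = M := by ext; rfl
    rwa [this]
  obtain ⟨p, hp, h⟩ := IsIntegral.of_mem_of_fg S hS x hx
  have h' : Polynomial.aeval x (p.map (algebraMap R K)) = 0 := by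
    rw [Polynomial.aeval_map_algebraMap]; exact h
  let b := Module.finBasis K V
  rw [LinearMap.trace_eq_matrix_trace K b]
  have := aux_matrix_trace (LinearMap.toMatrixAlgEquiv b x) p hp (by
    rw [Polynomial.aeval_algHom_apply, h', map_zero])
  exact IsIntegrallyClosed.isIntegral_iff.1 this

theorem aux_frac {K R : Type*} [Field K] [NumberField K] [CommRing R] [IsDomain R] [Algebra R K]
    (hR : Function.Injective (algebraMap R K))
    (hOK : ∀ x : K, IsIntegral ℤ x → x ∈ (algebraMap R K).range) : IsFractionRing R K := by
  have : FaithfulSMul R K := (faithfulSMul_iff_algebraMap_injective R K).2 hR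
  refine IsFractionRing.of_field R K (fun z => ?_)
  obtain ⟨a, b, hb, rfl⟩ := IsFractionRing.div_surjective (A := NumberField.RingOfIntegers K) z
  obtain ⟨x, hx⟩ := hOK _ a.isIntegral_coe
  obtain ⟨y, hy⟩ := hOK _ b.isIntegral_coe
  exact ⟨x, y, by rw [hx, hy]⟩

/-- Dual basis for an order. -/
theorem aux_dual_basis {R K H : Type*} [CommRing R] [IsDomain R] [Field K]
    [Algebra R K] [IsFractionRing R K] [AddCommGroup H] [Module K H] [Module R H]
    [IsScalarTower R K H] (X : Submodule R H) (hfg : X.FG) (hproj : Module.Projective R X)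
    (hinj : Function.Injective (ordNatMap R K H X))
    (hspan : Submodule.span K (X : Set H) = ⊤) :
    ∃ (n : ℕ) (e : Fin n → H) (φ : Fin n → Module.Dual K H), (∀ i, e i ∈ X) ∧
      (∀ i, ∀ x ∈ X, φ i x ∈ Set.range (algebraMap R K)) ∧
      ∀ h, h = ∑ i, φ i h • e i := by
  have hfin : Module.Finite R X := .of_fg hfg
  obtain ⟨n, f, g, -, -, hfg'⟩ := Module.Finite.exists_comp_eq_id_of_projective R X
  have hnat : ∀ (x : X) (c : K), ordNatMap R K H X (x ⊗ₜ c) = c • (x : H) := fun x c => rfl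
  have hsurj : Function.Surjective (ordNatMap R K H X) := by
    intro h
    have hh : h ∈ Submodule.span K (X : Set H) := hspan ▸ Submodule.mem_top
    induction hh using Submodule.span_induction with
    | mem x hx => exact ⟨(⟨x, hx⟩ : X) ⊗ₜ 1, by rw [hnat, one_smul]⟩
    | zero => exact ⟨0, map_zero _⟩
    | add x y _ _ hx hy =>
      obtain ⟨a, rfl⟩ := hx
      obtain ⟨b, rfl⟩ := hy
      exact ⟨a + b, map_add _ _ _⟩
    | smul c x hx0 hx =>
      obtain ⟨a, rfl⟩ := hx
      clear hx0
      refine ⟨TensorProduct.map LinearMap.id (LinearMap.mulLeft R c) a, ?_⟩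
      induction a with
      | zero => simp
      | tmul x d => simp [hnat, mul_smul]
      | add a b ha hb => rw [map_add, map_add, map_add, ha, hb, smul_add]
  let E : X ⊗[R] K ≃ₗ[R] H := LinearEquiv.ofBijective _ ⟨hinj, hsurj⟩
  let ψ : Fin n → (H →ₗ[R] K) := fun i =>
    (TensorProduct.lid R K).toLinearMap ∘ₗ
      (TensorProduct.map (LinearMap.proj i ∘ₗ g) LinearMap.id) ∘ₗ E.symm.toLinearMap
  let φ : Fin n → Module.Dual K H := fun i =>
    (ψ i).extendScalarsOfIsLocalization (nonZeroDivisors R) K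
  have hφ : ∀ i (x : X), φ i (x : H) = algebraMap R K (g x i) := by
    intro i x
    have : E.symm (x : H) = x ⊗ₜ 1 := by
      rw [LinearEquiv.symm_apply_eq]
      exact (by rw [hnat, one_smul] : (x : H) = ordNatMap R K H X (x ⊗ₜ 1))
    simp only [φ, ψ, LinearMap.extendScalarsOfIsLocalization_apply', LinearMap.comp_apply,
      LinearEquiv.coe_coe, this, TensorProduct.map_tmul, TensorProduct.lid_tmul,
      LinearMap.id_apply, LinearMap.proj_apply]
    rw [Algebra.smul_def, mul_one]
  refine ⟨n, fun i => (f (Pi.single i 1) : X), φ, fun i => (f (Pi.single i 1)).2,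
    fun i x hx => ⟨g ⟨x, hx⟩ i, (hφ i ⟨x, hx⟩).symm⟩, fun h => ?_⟩
  have hh : h ∈ Submodule.span K (X : Set H) := hspan ▸ Submodule.mem_top
  induction hh using Submodule.span_induction with
  | mem x hx =>
    have h1 : f (g ⟨x, hx⟩) = ⟨x, hx⟩ := LinearMap.congr_fun hfg' _
    have h2 : f (g ⟨x, hx⟩) = ∑ i, g ⟨x, hx⟩ i • f (Pi.single i 1) := by
      conv_lhs => rw [pi_eq_sum_univ' (g ⟨x, hx⟩)]
      rw [map_sum]
      refine Finset.sum_congr rfl fun i _ => ?_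
      rw [map_smul]
    have h3 := congrArg (fun y : X => (y : H)) (h1.symm.trans h2)
    simp only [Submodule.coe_sum, Submodule.coe_smul] at h3
    conv_lhs => rw [h3]
    refine Finset.sum_congr rfl fun i _ => ?_
    rw [hφ i ⟨x, hx⟩, algebraMap_smul]
  | zero => simp
  | add x y _ _ hx hy =>
    conv_lhs => rw [hx, hy]
    simp [add_smul, Finset.sum_add_distrib]
  | smul c x _ hx =>
    conv_lhs => rw [hx]
    simp [Finset.smul_sum, mul_smul]

theorem aux_cochar {K : Type*} [Field K]
    {R : Type*} [CommRing R] [IsDedekindDomain R] [Algebra R K] [IsFractionRing R K]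
    {H : Type*} [Ring H] [HopfAlgebra K H]
    [Module R H] [IsScalarTower R K H]
    (X : Submodule R H)
    (hX : IsHopfOrderWith R K H 1 (· * ·) ⊤
      (Coalgebra.comul (R := K) (A := H)) (Coalgebra.counit (R := K) (A := H))
      (HopfAlgebra.antipode (R := K) (A := H)) X)
    (V : Type*) [AddCommGroup V] [Module K V] [FiniteDimensional K V]
    (ρ : Module.Dual K H →ₗ[K] Module.End K V)
    (hone : ρ (Coalgebra.counit (R := K) (A := H)) = 1)
    (hmul : ∀ φ ψ : Module.Dual K H, ρ (dualConv K H φ ψ) = ρ φ * ρ ψ)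
    (h : H) (hh : ∀ φ : Module.Dual K H, φ h = LinearMap.trace K V (ρ φ)) : h ∈ X := by
  let _ : Module R V := Module.compHom V (algebraMap R K)
  have : IsScalarTower R K V := ⟨fun r k v => by
    rw [Algebra.smul_def, mul_smul]; rfl⟩
  obtain ⟨n, e, φ, he, hφ, hsum⟩ :=
    aux_dual_basis X hX.fg hX.projective hX.inj hX.span_eq
  let M : Submodule R (Module.End K V) := Submodule.span R (Set.range fun i => ρ (φ i))
  have hM : ∀ ψ : Module.Dual K H, (∀ x ∈ X, ψ x ∈ Set.range (algebraMap R K)) → ρ ψ ∈ M := by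
    intro ψ hψ
    have h1 : ψ = ∑ i, ψ (e i) • φ i := by
      ext x
      conv_lhs => rw [hsum x]
      simp [mul_comm]
    rw [h1, map_sum]
    refine Submodule.sum_mem _ fun i _ => ?_
    obtain ⟨r, hr⟩ := hψ _ (he i)
    rw [map_smul, ← hr, algebraMap_smul]
    exact Submodule.smul_mem _ _ (Submodule.subset_span ⟨i, rfl⟩)
  have hconv : ∀ α β : Module.Dual K H, (∀ x ∈ X, α x ∈ Set.range (algebraMap R K)) →
      (∀ x ∈ X, β x ∈ Set.range (algebraMap R K)) →
      ∀ x ∈ X, dualConv K H α β x ∈ Set.range (algebraMap R K) := by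
    intro α β hα hβ x hx
    have key : ∀ z ∈ spanPairs R K H X X,
        TensorProduct.lid K K (TensorProduct.map α β z) ∈ (algebraMap R K).range := by
      intro z hz
      unfold spanPairs at hz
      induction hz using Submodule.span_induction with
      | mem z hz =>
        obtain ⟨a, ha, b, hb, rfl⟩ := hz
        rw [TensorProduct.map_tmul, TensorProduct.lid_tmul]
        exact Subring.mul_mem _ (hα a ha) (hβ b hb)
      | zero => simp
      | add a b _ _ ha hb => rw [map_add, map_add]; exact Subring.add_mem _ ha hb
      | smul r a _ ha =>
        rw [← algebraMap_smul K r a, map_smul, map_smul]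
        exact Subring.mul_mem _ ⟨r, rfl⟩ ha
    exact key _ (hX.comul_mem x hx)
  have hMmul : ∀ x ∈ M, ∀ y ∈ M, x * y ∈ M := by
    intro x hx y hy
    have hmm : x * y ∈ M * M := Submodule.mul_mem_mul hx hy
    rw [Submodule.span_mul_span] at hmm
    refine Submodule.span_le.2 ?_ hmm
    rintro _ ⟨_, ⟨i, rfl⟩, _, ⟨j, rfl⟩, rfl⟩
    simp only [← hmul]
    exact hM _ (hconv _ _ (hφ i) (hφ j))
  rw [hsum h]
  refine Submodule.sum_mem _ fun i _ => ?_
  have := aux_trace_mem M (Submodule.fg_span (Set.finite_range _))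
    (hone ▸ hM _ hX.counit_mem) hMmul _ (hM _ (hφ i))
  rw [← hh] at this
  obtain ⟨r, hr⟩ := this
  rw [← hr, algebraMap_smul]
  exact Submodule.smul_mem _ _ (he i)

/-- **Characters lie in the dual order, cocharacters in the order** (Proposition 1.2 of
Cuadra–Meir).  Let `K` be a number field, `R ⊂ K` a Dedekind domain with `𝓞_K ⊆ R`, `H` a
finite-dimensional Hopf algebra over `K` and `X` a Hopf order of `H` over `R`.  Then:
(1) the character of any finite-dimensional representation of `H` maps `X` into `R`, i.e.
it belongs to the dual order `X⋆`; (2) any cocharacter of `H` — an element `h ∈ H`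
representing, under `H ≅ H**`, the character of a finite-dimensional representation `ρ` of
the convolution algebra `H*` — belongs to `X`; in particular (3) every group-like element
of `H` belongs to `X`. -/
theorem characters_mem_dual_order_and_cocharacters_mem_order
    (K : Type*) [Field K] [NumberField K]
    (R : Type*) [CommRing R] [IsDedekindDomain R] [Algebra R K]
    (hR : Function.Injective (algebraMap R K))
    (hOK : ∀ x : K, IsIntegral ℤ x → x ∈ (algebraMap R K).range)
    (H : Type*) [Ring H] [HopfAlgebra K H] [FiniteDimensional K H]
    [Module R H] [IsScalarTower R K H]
    (X : Submodule R H)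
    (hX : IsHopfOrderWith R K H 1 (· * ·) ⊤
      (Coalgebra.comul (R := K) (A := H)) (Coalgebra.counit (R := K) (A := H))
      (HopfAlgebra.antipode (R := K) (A := H)) X) :
    (∀ (V : Type*) [AddCommGroup V] [Module K V] [FiniteDimensional K V]
      (ρ : H →ₐ[K] Module.End K V),
        ∀ x ∈ X, LinearMap.trace K V (ρ x) ∈ Set.range (algebraMap R K)) ∧
    (∀ (V : Type*) [AddCommGroup V] [Module K V] [FiniteDimensional K V]
      (ρ : Module.Dual K H →ₗ[K] Module.End K V),
        ρ (Coalgebra.counit (R := K) (A := H)) = 1 →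
        (∀ φ ψ : Module.Dual K H, ρ (dualConv K H φ ψ) = ρ φ * ρ ψ) →
        ∀ h : H, (∀ φ : Module.Dual K H, φ h = LinearMap.trace K V (ρ φ)) → h ∈ X) ∧
    (∀ h : H, Coalgebra.comul (R := K) (A := H) h = h ⊗ₜ[K] h →
      Coalgebra.counit (R := K) (A := H) h = 1 → h ∈ X) := by
  have : IsFractionRing R K := aux_frac hR hOK
  refine ⟨?_, ?_, ?_⟩
  · intro V _ _ _ ρ x hx
    let _ : Module R V := Module.compHom V (algebraMap R K)
    have : IsScalarTower R K V := ⟨fun r k v => by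
      rw [Algebra.smul_def, mul_smul]; rfl⟩
    refine aux_trace_mem (X.map (ρ.toLinearMap.restrictScalars R)) (hX.fg.map _)
      ⟨1, hX.one_mem, map_one ρ⟩ ?_ _ ⟨x, hx, rfl⟩
    rintro _ ⟨a, ha, rfl⟩ _ ⟨b, hb, rfl⟩
    exact ⟨a * b, hX.mul_mem a ha b hb, map_mul ρ a b⟩
  · intro V _ _ _ ρ h1 h2 h hh
    exact aux_cochar X hX V ρ h1 h2 h hh
  · intro h h1 h2
    refine aux_cochar X hX K
      ((LinearMap.toSpanSingleton K (Module.End K K) 1) ∘ₗ Module.Dual.eval K H h) ?_ ?_ h ?_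
    · simp [h2]
    · intro φ ψ
      simp [dualConv, h1, mul_smul, smul_comm (φ h) (ψ h)]
    · intro φ
      simp

end
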